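/- Kernel estimate, truncated case: let γ ∈ {2,3}. There is a constant c > 0 such that for every N ∈ 2^ℕ (N ≥ 1), the kernel K₁(x,t) = ∫_ℝ e^{−itξ² + ixξ} χ_{[−2,2]}(t) ψ(ξ/(4N)) dξ satisfies ‖K₁‖_{L^{γ/2}_x L^∞_t(ℝ×[−1,1])} ≤ c N^{2/γ}. -/

import Mathlib

open MeasureTheory Complex
open scoped ENNReal

noncomputable section

/-- Fourier transform (normalizing constant dropped, as in the paper). -/
def ft (u : ℝ → ℂ) (ξ : ℝ) : ℂ := ∫ x : ℝ, Complex.exp (-(Complex.I) * x * ξ) * u x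

/-- Schrödinger propagator `e^{itΔ}u(x)`. -/
def schrod (u : ℝ → ℂ) (x t : ℝ) : ℂ :=
  ∫ ξ : ℝ, Complex.exp (Complex.I * (x * ξ - t * ξ ^ 2)) * ft u ξ

/-- Mixed norm `L^p_x L^q_t (ℝ × I)` (space outermost). -/
def mixed (p q : ℝ≥0∞) (I : Set ℝ) (F : ℝ → ℝ → ℂ) : ℝ≥0∞ :=
  if p = ⊤ then essSup (fun x => eLpNorm (F x) q (volume.restrict I)) volume
  else (∫⁻ x : ℝ, (eLpNorm (F x) q (volume.restrict I)) ^ p.toReal) ^ (1 / p.toReal)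

/-- Mixed norm `L^q_t L^p_x (I × ℝ)` (time outermost). -/
def mixedT (q p : ℝ≥0∞) (I : Set ℝ) (F : ℝ → ℝ → ℂ) : ℝ≥0∞ :=
  if q = ⊤ then essSup (fun t => eLpNorm (fun x => F x t) p volume) (volume.restrict I)
  else (∫⁻ t in I, (eLpNorm (fun x => F x t) p volume) ^ q.toReal) ^ (1 / q.toReal)

/-- Littlewood–Paley symbol `ψ_N(ξ) = ψ(ξ/N) − ψ(2ξ/N)`. -/
def psiN (ψ : ℝ → ℝ) (N ξ : ℝ) : ℝ := ψ (ξ / N) - ψ (2 * ξ / N)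

/-- Littlewood–Paley projection `P_N` (Fourier multiplier with symbol `ψ_N`). -/
def proj (ψ : ℝ → ℝ) (N : ℝ) (f : ℝ → ℂ) (x : ℝ) : ℂ :=
  ∫ ξ : ℝ, Complex.exp (Complex.I * x * ξ) * ((psiN ψ N ξ : ℝ) : ℂ) * ft f ξ

/-- A smooth cutoff as fixed in the paper: `ψ : ℝ → [0,1]` smooth, supported in
`{|ξ| ≤ 4}`, equal to `1` on `{|ξ| ≤ 2}`. -/
structure IsCutoff (ψ : ℝ → ℝ) : Prop where
  smooth : ContDiff ℝ (⊤ : ℕ∞) ψ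
  mem_Icc : ∀ ξ, ψ ξ ∈ Set.Icc (0 : ℝ) 1
  supp : ∀ ξ, 4 < |ξ| → ψ ξ = 0
  one : ∀ ξ, |ξ| ≤ 2 → ψ ξ = 1

/-- The Schrödinger operator `(i∂_t + Δ)u`. -/
def LS (u : ℝ → ℝ → ℂ) (x t : ℝ) : ℂ :=
  Complex.I * deriv (fun s => u x s) t + deriv (fun y => deriv (fun z => u z t) y) x
theorem hasDerivAt_chirp (y s η : ℝ) :
    HasDerivAt (fun η : ℝ => cexp (I * (y * η - s * η ^ 2)))
      (cexp (I * (y * η - s * η ^ 2)) * (I * (y - 2 * s * η))) η := by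
  have h : HasDerivAt (fun η : ℂ => cexp (I * (y * η - s * η ^ 2)))
      (cexp (I * (y * η - s * η ^ 2)) * (I * (y - 2 * s * η))) (η : ℂ) := by
    have h1 : HasDerivAt (fun η : ℂ => I * (y * η - s * η ^ 2)) (I * (y - 2 * s * η)) (η : ℂ) := by
      have := ((((hasDerivAt_id (η : ℂ)).const_mul (y : ℂ)).sub
        (((hasDerivAt_id (η : ℂ)).pow 2).const_mul (s : ℂ))).const_mul I)
      refine this.congr_deriv ?_
      simp; ring
    exact h1.cexp
  exact h.comp_ofReal

theorem norm_chirp (y s η : ℝ) : ‖cexp (I * (y * η - s * η ^ 2))‖ = 1 := by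
  rw [show I * ((y : ℂ) * η - s * η ^ 2) = ((y * η - s * η ^ 2 : ℝ) : ℂ) * I by push_cast; ring]
  exact Complex.norm_exp_ofReal_mul_I _

theorem norm_integral_chirp_le_of_one_le {s b : ℝ} (hs : |s| = 1) (hb : 1 ≤ b) :
    ‖∫ v in (1 : ℝ)..b, cexp (I * ((0 : ℝ) * v - s * v ^ 2))‖ ≤ 3 / 2 := by
  set e : ℝ → ℂ := fun v => cexp (I * ((0 : ℝ) * v - s * v ^ 2)) with he
  have hs0 : (s : ℂ) ≠ 0 := by
    have : s ≠ 0 := by rintro rfl; simp at hs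
    exact_mod_cast this
  have hns : ‖(s : ℂ)‖ = 1 := by rw [Complex.norm_real, Real.norm_eq_abs, hs]
  have hen : ∀ v, ‖e v‖ = 1 := fun v => norm_chirp 0 s v
  have hec : Continuous e := by
    rw [he]; fun_prop
  have hpos : ∀ v ∈ Set.uIcc 1 b, 0 < v := by
    intro v hv
    rw [Set.uIcc_of_le hb] at hv
    linarith [hv.1]
  have hder : ∀ v ∈ Set.uIcc 1 b,
      HasDerivAt (fun v : ℝ => e v / (-2 * I * s * v)) (e v - e v / (-2 * I * s * v ^ 2)) v := by
    intro v hv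
    have hv0 : (v : ℂ) ≠ 0 := by exact_mod_cast (hpos v hv).ne'
    have h1 : HasDerivAt (fun v : ℝ => -2 * I * s * (v : ℂ)) (-2 * I * s) v := by
      simpa using (Complex.ofRealCLM.hasDerivAt (x := v)).const_mul (-2 * I * (s : ℂ))
    refine ((hasDerivAt_chirp 0 s v).div h1 (by simp [hs0, hv0])).congr_deriv ?_
    simp only [he]
    field_simp
    push_cast
    ring
  have hc2 : ContinuousOn (fun v : ℝ => e v / (-2 * I * s * v ^ 2)) (Set.uIcc 1 b) := by
    refine hec.continuousOn.div (by fun_prop) ?_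
    intro v hv
    have hv0 : (v : ℂ) ≠ 0 := by exact_mod_cast (hpos v hv).ne'
    simp [hs0, hv0]
  have hi2 : IntervalIntegrable (fun v : ℝ => e v / (-2 * I * s * v ^ 2)) volume 1 b :=
    hc2.intervalIntegrable
  have hi1 : IntervalIntegrable e volume 1 b := hec.intervalIntegrable _ _
  have key := intervalIntegral.integral_eq_sub_of_hasDerivAt hder (hi1.sub hi2)
  rw [intervalIntegral.integral_sub hi1 hi2, sub_eq_iff_eq_add] at key
  have hb2 : ‖∫ v in (1 : ℝ)..b, e v / (-2 * I * s * v ^ 2)‖ ≤ 1 / 2 := by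
    have hic : IntervalIntegrable (fun v : ℝ => (1 / 2) * (v ^ 2)⁻¹) volume 1 b := by
      refine ContinuousOn.intervalIntegrable ?_
      refine continuousOn_const.mul (ContinuousOn.inv₀ (by fun_prop) ?_)
      intro v hv
      exact (pow_pos (hpos v hv) 2).ne'
    have hD : ∀ v ∈ Set.uIcc 1 b,
        HasDerivAt (fun v : ℝ => -(1 / 2) * v⁻¹) ((1 / 2) * (v ^ 2)⁻¹) v := by
      intro v hv
      refine ((hasDerivAt_inv (hpos v hv).ne').const_mul (-(1 / 2))).congr_deriv ?_
      ring
    have h3 := intervalIntegral.integral_eq_sub_of_hasDerivAt hD hic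
    refine (intervalIntegral.norm_integral_le_of_norm_le hb ?_ hic).trans ?_
    · refine Filter.Eventually.of_forall fun v hv => ?_
      simp [hen, hs]
      exact le_of_eq (by ring)
    · rw [h3]
      have : 0 < b⁻¹ := by positivity
      norm_num
      linarith
  rw [key]
  have hbound : ∀ v : ℝ, 1 ≤ v → ‖e v / (-2 * I * s * v)‖ ≤ 1 / 2 := by
    intro v hv
    simp only [norm_div, hen, norm_mul, norm_neg, Complex.norm_I, hns, Complex.norm_real,
      Real.norm_eq_abs, abs_of_pos (show 0 < v by linarith)]
    norm_num
    have : v⁻¹ ≤ 1 := inv_le_one_of_one_le₀ hv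
    linarith
  calc _ ≤ ‖e b / (-2 * I * s * b)‖ + ‖e 1 / (-2 * I * s * (1 : ℝ))‖
        + ‖∫ v in (1 : ℝ)..b, e v / (-2 * I * s * v ^ 2)‖ :=
      (norm_add_le _ _).trans (add_le_add_left (norm_sub_le _ _) _)
    _ ≤ _ := by linarith [hbound b hb, hbound 1 le_rfl]

theorem norm_integral_chirp_zero_le {s : ℝ} (hs : |s| = 1) (b : ℝ) :
    ‖∫ v in (0 : ℝ)..b, cexp (I * ((0 : ℝ) * v - s * v ^ 2))‖ ≤ 5 / 2 := by
  have hint : ∀ a b : ℝ, IntervalIntegrable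
      (fun v : ℝ => cexp (I * ((0 : ℝ) * v - s * v ^ 2))) volume a b :=
    fun a b => Continuous.intervalIntegrable (by fun_prop) _ _
  have hsmall : ∀ b : ℝ, |b| ≤ 1 →
      ‖∫ v in (0 : ℝ)..b, cexp (I * ((0 : ℝ) * v - s * v ^ 2))‖ ≤ 1 := by
    intro b hb
    refine (intervalIntegral.norm_integral_le_of_norm_le_const
      (fun v _ => (norm_chirp 0 s v).le)).trans ?_
    simpa using hb
  have hnn : ∀ b : ℝ, 0 ≤ b →
      ‖∫ v in (0 : ℝ)..b, cexp (I * ((0 : ℝ) * v - s * v ^ 2))‖ ≤ 5 / 2 := by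
    intro b hb
    rcases le_total b 1 with h | h
    · linarith [hsmall b (abs_le.2 ⟨by linarith, h⟩)]
    · rw [← intervalIntegral.integral_add_adjacent_intervals (hint 0 1) (hint 1 b)]
      refine (norm_add_le _ _).trans ?_
      linarith [hsmall 1 (by simp), norm_integral_chirp_le_of_one_le hs h]
  rcases le_total 0 b with h | h
  · exact hnn b h
  · have := hnn (-b) (by linarith)
    rw [← norm_neg, ← intervalIntegral.integral_symm]
    have h2 := intervalIntegral.integral_comp_neg (a := b) (b := 0)
      (fun v : ℝ => cexp (I * ((0 : ℝ) * v - s * v ^ 2)))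
    simp only [neg_zero] at h2
    have heven : ∀ v : ℝ, cexp (I * ((0 : ℝ) * ((-v : ℝ) : ℂ) - s * ((-v : ℝ) : ℂ) ^ 2)) =
        cexp (I * ((0 : ℝ) * v - s * v ^ 2)) := by
      intro v
      push_cast
      congr 1
      ring
    rw [← h2] at this
    simpa only [heven] using this

theorem norm_integral_chirp_le (y : ℝ) {s : ℝ} (hs : s ≠ 0) (a b : ℝ) :
    ‖∫ u in a..b, cexp (I * (y * u - s * u ^ 2))‖ ≤ 5 / √|s| := by
  have hpos : 0 < |s| := abs_pos.2 hs
  set m := √|s| with hm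
  have hm0 : 0 < m := Real.sqrt_pos.2 hpos
  have hm2 : m ^ 2 = |s| := Real.sq_sqrt hpos.le
  set σ := s / |s| with hσ
  have hσ1 : |σ| = 1 := by rw [hσ, abs_div, abs_abs, div_self hpos.ne']
  have hsσ : s = σ * m ^ 2 := by rw [hσ, hm2]; field_simp
  set g : ℝ → ℂ := fun v => cexp (I * ((0 : ℝ) * v - σ * v ^ 2)) with hg
  have hgint : ∀ a b : ℝ, IntervalIntegrable g volume a b :=
    fun a b => Continuous.intervalIntegrable (by rw [hg]; fun_prop) _ _
  set d := m * (y / (2 * s)) with hd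
  have hfac : ∀ u : ℝ, cexp (I * (y * u - s * u ^ 2)) =
      cexp (((y ^ 2 / (4 * s) : ℝ) : ℂ) * I) * g (m * u - d) := by
    intro u
    rw [hg, ← Complex.exp_add]
    congr 1
    have h : y * u - s * u ^ 2 = y ^ 2 / (4 * s) - σ * (m * u - d) ^ 2 := by
      have : σ * (m * u - d) ^ 2 = s * (u - y / (2 * s)) ^ 2 := by
        rw [hd]; nth_rewrite 2 [hsσ]; ring
      rw [this]; field_simp; ring
    have hc : (y : ℂ) * u - s * u ^ 2 = ((y ^ 2 / (4 * s) - σ * (m * u - d) ^ 2 : ℝ) : ℂ) := by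
      rw [← h]; push_cast; ring
    rw [hc]; push_cast; ring
  simp_rw [hfac]
  rw [intervalIntegral.integral_const_mul, intervalIntegral.integral_comp_mul_sub _ hm0.ne',
    norm_mul, Complex.norm_exp_ofReal_mul_I, one_mul, norm_smul,
    ← intervalIntegral.integral_interval_sub_left (hgint 0 _) (hgint 0 _)]
  have h5 := norm_sub_le (∫ v in (0 : ℝ)..(m * b - d), g v) (∫ v in (0 : ℝ)..(m * a - d), g v)
  have h6 := norm_integral_chirp_zero_le hσ1 (m * b - d)
  have h7 := norm_integral_chirp_zero_le hσ1 (m * a - d)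
  rw [norm_inv, Real.norm_of_nonneg hm0.le, inv_mul_eq_div]
  gcongr
  linarith

namespace IsCutoff

variable {ψ : ℝ → ℝ}

theorem hasDerivAt (hψ : IsCutoff ψ) (x : ℝ) : HasDerivAt ψ (deriv ψ x) x :=
  (hψ.smooth.differentiable (by simp) x).hasDerivAt

theorem contDiff_deriv (hψ : IsCutoff ψ) : ContDiff ℝ 1 (deriv ψ) := by
  have h : ContDiff ℝ (1 + 1) ψ := hψ.smooth.of_le (by norm_cast)
  exact (contDiff_succ_iff_deriv.1 h).2.2

theorem hasDerivAt_deriv (hψ : IsCutoff ψ) (x : ℝ) :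
    HasDerivAt (deriv ψ) (deriv (deriv ψ) x) x :=
  (hψ.contDiff_deriv.differentiable (by simp) x).hasDerivAt

theorem continuous_deriv (hψ : IsCutoff ψ) : Continuous (deriv ψ) :=
  hψ.contDiff_deriv.continuous

theorem continuous_deriv_deriv (hψ : IsCutoff ψ) : Continuous (deriv (deriv ψ)) :=
  hψ.contDiff_deriv.continuous_deriv le_rfl

theorem eventuallyEq_zero (hψ : IsCutoff ψ) {x : ℝ} (hx : 4 < |x|) : ψ =ᶠ[nhds x] fun _ => 0 := by
  have : ∀ᶠ y in nhds x, 4 < |y| := continuous_abs.continuousAt.eventually (lt_mem_nhds hx)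
  exact this.mono fun y hy => hψ.supp y hy

theorem deriv_eq_zero (hψ : IsCutoff ψ) {x : ℝ} (hx : 4 < |x|) : deriv ψ x = 0 := by
  rw [(hψ.eventuallyEq_zero hx).deriv_eq]; simp

theorem integral_mul_eq (hψ : IsCutoff ψ) (f : ℝ → ℂ) :
    ∫ η : ℝ, f η * (ψ η : ℂ) = ∫ η in (-5 : ℝ)..5, f η * (ψ η : ℂ) := by
  refine (intervalIntegral.integral_eq_integral_of_support_subset ?_).symm
  intro η hη
  by_contra h
  refine hη ?_
  have : 4 < |η| := by
    by_contra h4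
    have := abs_le.1 (not_lt.1 h4)
    exact h ⟨by linarith, by linarith⟩
  simp [hψ.supp η this]

theorem exists_deriv_bound (hψ : IsCutoff ψ) : ∃ M : ℝ, 0 ≤ M ∧
    ∀ x ∈ Set.Icc (-5 : ℝ) 5, |deriv ψ x| ≤ M ∧ |deriv (deriv ψ) x| ≤ M := by
  obtain ⟨M₁, h₁⟩ := (isCompact_Icc (a := (-5 : ℝ)) (b := 5)).exists_bound_of_continuousOn
    hψ.continuous_deriv.continuousOn
  obtain ⟨M₂, h₂⟩ := (isCompact_Icc (a := (-5 : ℝ)) (b := 5)).exists_bound_of_continuousOn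
    hψ.continuous_deriv_deriv.continuousOn
  refine ⟨max (max M₁ M₂) 0, le_max_right _ _, fun x hx => ⟨?_, ?_⟩⟩
  · exact (h₁ x hx).trans ((le_max_left _ _).trans (le_max_left _ _))
  · exact (h₂ x hx).trans ((le_max_right _ _).trans (le_max_left _ _))

theorem abs_le_one (hψ : IsCutoff ψ) (x : ℝ) : |ψ x| ≤ 1 :=
  abs_le.2 ⟨by linarith [(hψ.mem_Icc x).1], (hψ.mem_Icc x).2⟩

theorem norm_oscillatory_le (hψ : IsCutoff ψ) (y s : ℝ) :
    ‖∫ η : ℝ, cexp (I * (y * η - s * η ^ 2)) * (ψ η : ℂ)‖ ≤ 10 := by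
  rw [hψ.integral_mul_eq]
  refine (intervalIntegral.norm_integral_le_of_norm_le_const (C := 1) fun η _ => ?_).trans ?_
  · rw [norm_mul, norm_chirp, one_mul, Complex.norm_real]
    exact hψ.abs_le_one η
  · norm_num

theorem norm_oscillatory_le_div_sqrt (hψ : IsCutoff ψ) {M : ℝ}
    (hM : ∀ x ∈ Set.Icc (-5 : ℝ) 5, |deriv ψ x| ≤ M) (y : ℝ) {s : ℝ} (hs : s ≠ 0) :
    ‖∫ η : ℝ, cexp (I * (y * η - s * η ^ 2)) * (ψ η : ℂ)‖ ≤ 50 * M / √|s| := by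
  rw [hψ.integral_mul_eq]
  have hcont : Continuous fun η : ℝ => cexp (I * (y * η - s * η ^ 2)) := by fun_prop
  have hE : ∀ x : ℝ, HasDerivAt (fun x => ∫ η in (-5 : ℝ)..x, cexp (I * (y * η - s * η ^ 2)))
      (cexp (I * (y * x - s * x ^ 2))) x := fun x =>
    intervalIntegral.integral_hasDerivAt_right (hcont.intervalIntegrable _ _)
      (hcont.stronglyMeasurableAtFilter _ _) hcont.continuousAt
  have hparts := intervalIntegral.integral_mul_deriv_eq_deriv_mul
    (a := -5) (b := 5) (u := fun x => (ψ x : ℂ)) (u' := fun x => ((deriv ψ x : ℝ) : ℂ))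
    (fun x _ => (hψ.hasDerivAt x).ofReal_comp) (fun x _ => hE x)
    ((Complex.continuous_ofReal.comp hψ.continuous_deriv).intervalIntegrable _ _)
    (hcont.intervalIntegrable _ _)
  simp only [hψ.supp 5 (by norm_num), hψ.supp (-5) (by norm_num), Complex.ofReal_zero, zero_mul,
    sub_zero, zero_sub] at hparts
  simp_rw [mul_comm _ ((ψ _ : ℝ) : ℂ)]
  rw [hparts, norm_neg]
  refine (intervalIntegral.norm_integral_le_of_norm_le_const (C := M * (5 / √|s|))
    fun x hx => ?_).trans (le_of_eq ?_)
  · rw [Set.uIoc_of_le (by norm_num)] at hx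
    rw [norm_mul, Complex.norm_real]
    have h1 := hM x ⟨hx.1.le, hx.2⟩
    exact mul_le_mul h1 (norm_integral_chirp_le y hs _ _) (norm_nonneg _) ((abs_nonneg _).trans h1)
  · norm_num; ring

theorem norm_oscillatory_le_div_sq (hψ : IsCutoff ψ) {M : ℝ}
    (hM : ∀ x ∈ Set.Icc (-5 : ℝ) 5, |deriv ψ x| ≤ M ∧ |deriv (deriv ψ) x| ≤ M)
    {y s : ℝ} (hy : y ≠ 0) (hs : 20 * |s| ≤ |y|) :
    ‖∫ η : ℝ, cexp (I * (y * η - s * η ^ 2)) * (ψ η : ℂ)‖ ≤ 10 * (7 * M + 1) / y ^ 2 := by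
  rw [hψ.integral_mul_eq]
  set e : ℝ → ℂ := fun η => cexp (I * (y * η - s * η ^ 2)) with he
  set d : ℝ → ℝ := fun η => y - 2 * s * η with hd
  have hy0 : 0 < |y| := abs_pos.2 hy
  have hdl : ∀ η ∈ Set.uIcc (-5 : ℝ) 5, |y| / 2 ≤ |d η| := by
    intro η hη
    rw [Set.uIcc_of_le (by norm_num)] at hη
    have h1 : |η| ≤ 5 := abs_le.2 hη
    have h2 : |2 * s * η| ≤ |y| / 2 := by
      rw [abs_mul, abs_mul, abs_two]
      nlinarith [abs_nonneg s, abs_nonneg η]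
    have h3 := abs_sub_abs_le_abs_sub y (2 * s * η)
    simp only [hd]
    linarith
  have hd0 : ∀ η ∈ Set.uIcc (-5 : ℝ) 5, d η ≠ 0 := fun η hη =>
    abs_pos.1 (lt_of_lt_of_le (by positivity) (hdl η hη))
  have hdd : ∀ η, HasDerivAt (fun η => (d η : ℂ)) (-2 * s) η := by
    intro η
    have h : HasDerivAt d (-2 * s) η := by
      refine (((hasDerivAt_id η).const_mul (2 * s)).const_sub y).congr_deriv ?_
      ring
    simpa using h.ofReal_comp
  have hec : Continuous e := by rw [he]; fun_prop
  have hdc : Continuous d := by rw [hd]; fun_prop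
  have hψc : Continuous ψ := hψ.smooth.continuous
  set R : ℝ → ℝ := fun η => deriv (deriv ψ) η / d η ^ 2 + 6 * s * deriv ψ η / d η ^ 3
    + 12 * s ^ 2 * ψ η / d η ^ 4 with hR
  have hP : ∀ η ∈ Set.uIcc (-5 : ℝ) 5, HasDerivAt
      (fun η => e η * (-I * ψ η / d η + deriv ψ η / d η ^ 2 + 2 * s * ψ η / d η ^ 3))
      (e η * ψ η + e η * R η) η := by
    intro η hη
    have hdη : (d η : ℂ) ≠ 0 := by exact_mod_cast hd0 η hη
    have h0 := (hψ.hasDerivAt η).ofReal_comp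
    have h1 := (hψ.hasDerivAt_deriv η).ofReal_comp
    have hsum := ((h0.const_mul (-I)).div (hdd η) hdη).add
      (h1.div ((hdd η).pow 2) (pow_ne_zero 2 hdη)) |>.add
      ((h0.const_mul (2 * (s : ℂ))).div ((hdd η).pow 3) (pow_ne_zero 3 hdη))
    refine ((hasDerivAt_chirp y s η).mul hsum).congr_deriv ?_
    have hyd : (y : ℂ) - 2 * s * η = d η := by simp [hd]
    rw [hyd]
    simp only [hR, he, Pi.add_apply, Pi.pow_apply, Pi.div_apply]
    push_cast
    field_simp
    ring_nf
    simp only [I_sq]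
    ring
  have hRc : ContinuousOn R (Set.uIcc (-5 : ℝ) 5) := by
    have h1 := hψ.continuous_deriv.continuousOn (s := Set.uIcc (-5 : ℝ) 5)
    have h2 := hψ.continuous_deriv_deriv.continuousOn (s := Set.uIcc (-5 : ℝ) 5)
    have h3 := hψc.continuousOn (s := Set.uIcc (-5 : ℝ) 5)
    have h4 := hdc.continuousOn (s := Set.uIcc (-5 : ℝ) 5)
    exact ((h2.div (h4.pow 2) fun η hη => pow_ne_zero 2 (hd0 η hη)).add
      ((continuousOn_const.mul h1).div (h4.pow 3) fun η hη => pow_ne_zero 3 (hd0 η hη))).add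
      ((continuousOn_const.mul h3).div (h4.pow 4) fun η hη => pow_ne_zero 4 (hd0 η hη))
  have hi1 : IntervalIntegrable (fun η => e η * (ψ η : ℂ)) volume (-5) 5 :=
    (hec.mul (Complex.continuous_ofReal.comp hψc)).intervalIntegrable _ _
  have hi2 : IntervalIntegrable (fun η => e η * (R η : ℂ)) volume (-5) 5 :=
    (hec.continuousOn.mul
      (Complex.continuous_ofReal.comp_continuousOn hRc)).intervalIntegrable
  have key := intervalIntegral.integral_eq_sub_of_hasDerivAt hP (hi1.add hi2)
  rw [intervalIntegral.integral_add hi1 hi2] at key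
  simp only [hψ.supp 5 (by norm_num), hψ.supp (-5) (by norm_num),
    hψ.deriv_eq_zero (x := 5) (by norm_num), hψ.deriv_eq_zero (x := -5) (by norm_num),
    Complex.ofReal_zero, mul_zero, zero_div, add_zero, sub_zero] at key
  rw [eq_neg_of_add_eq_zero_left key, norm_neg]
  have hRb : ∀ η ∈ Set.Icc (-5 : ℝ) 5, |R η| ≤ (7 * M + 1) / y ^ 2 := by
    intro η hη
    have hM0 : 0 ≤ M := (abs_nonneg _).trans (hM η hη).1
    have hD := hdl η (by rwa [Set.uIcc_of_le (by norm_num)])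
    have hD0 : 0 < |d η| := by linarith
    have hq : |y| / |d η| ≤ 2 := by rw [div_le_iff₀ hD0]; linarith
    set q := |y| / |d η| with hqdef
    have hq0 : 0 ≤ q := by positivity
    have hdq : |d η|⁻¹ = q / |y| := by rw [hqdef]; field_simp
    set a := |s| / |y| with hadef
    have ha0 : 0 ≤ a := by positivity
    have ha : a ≤ 1 / 20 := by rw [hadef, div_le_iff₀ hy0]; linarith
    have hsa : |s| = a * |y| := by rw [hadef]; field_simp
    have e1 : |deriv (deriv ψ) η / d η ^ 2| = |deriv (deriv ψ) η| * q ^ 2 / y ^ 2 := by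
      rw [abs_div, abs_pow, div_eq_mul_inv, ← inv_pow, hdq, ← sq_abs y]; ring
    have e2 : |6 * s * deriv ψ η / d η ^ 3| = 6 * a * |deriv ψ η| * q ^ 3 / y ^ 2 := by
      rw [abs_div, abs_pow, div_eq_mul_inv, ← inv_pow, hdq, ← sq_abs y, abs_mul, abs_mul, hsa,
        abs_of_pos (show (0 : ℝ) < 6 by norm_num)]
      field_simp
    have e3 : |12 * s ^ 2 * ψ η / d η ^ 4| = 12 * a ^ 2 * |ψ η| * q ^ 4 / y ^ 2 := by
      rw [abs_div, abs_pow, div_eq_mul_inv, ← inv_pow, hdq, ← sq_abs y, abs_mul, abs_mul, abs_pow,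
        hsa, abs_of_pos (show (0 : ℝ) < 12 by norm_num)]
      field_simp
    have b1 : |deriv (deriv ψ) η| * q ^ 2 ≤ M * 2 ^ 2 := by
      gcongr; exact (hM η hη).2
    have b2 : 6 * a * |deriv ψ η| * q ^ 3 ≤ 6 * (1 / 20) * M * 2 ^ 3 := by
      gcongr; exact (hM η hη).1
    have b3 : 12 * a ^ 2 * |ψ η| * q ^ 4 ≤ 12 * (1 / 20) ^ 2 * 1 * 2 ^ 4 := by
      gcongr; exact hψ.abs_le_one η
    calc |R η| ≤ _ := (abs_add_le _ _).trans (add_le_add_left (abs_add_le _ _) _)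
      _ = (|deriv (deriv ψ) η| * q ^ 2 + 6 * a * |deriv ψ η| * q ^ 3
          + 12 * a ^ 2 * |ψ η| * q ^ 4) / y ^ 2 := by rw [e1, e2, e3]; ring
      _ ≤ _ := div_le_div_of_nonneg_right (by linarith) (sq_nonneg y)
  refine (intervalIntegral.norm_integral_le_of_norm_le_const (C := (7 * M + 1) / y ^ 2)
    fun x hx => ?_).trans (le_of_eq ?_)
  · rw [Set.uIoc_of_le (by norm_num)] at hx
    rw [norm_mul, he, norm_chirp, one_mul, Complex.norm_real]
    exact hRb x ⟨hx.1.le, hx.2⟩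
  · norm_num; ring

theorem exists_oscillatory_bound (hψ : IsCutoff ψ) : ∃ C : ℝ, 0 < C ∧ ∀ y s : ℝ, y ≠ 0 →
    ‖∫ η : ℝ, cexp (I * (y * η - s * η ^ 2)) * (ψ η : ℂ)‖ ≤ C / √|y| ∧
    (20 * |s| ≤ |y| →
      ‖∫ η : ℝ, cexp (I * (y * η - s * η ^ 2)) * (ψ η : ℂ)‖ ≤ C / y ^ 2) := by
  obtain ⟨M, hM0, hM⟩ := hψ.exists_deriv_bound
  refine ⟨250 * M + 10, by positivity, fun y s hy => ?_⟩
  have hy0 : 0 < |y| := abs_pos.2 hy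
  have hsy : 0 < √|y| := Real.sqrt_pos.2 hy0
  have hfar : 20 * |s| ≤ |y| →
      ‖∫ η : ℝ, cexp (I * (y * η - s * η ^ 2)) * (ψ η : ℂ)‖ ≤ (250 * M + 10) / y ^ 2 := by
    intro h
    refine (hψ.norm_oscillatory_le_div_sq hM hy h).trans ?_
    gcongr
    linarith
  refine ⟨?_, hfar⟩
  rcases le_or_gt (20 * |s|) |y| with h | h
  · rcases le_total |y| 1 with h1 | h1
    · refine (hψ.norm_oscillatory_le y s).trans ?_
      rw [le_div_iff₀ hsy]
      have : √|y| ≤ 1 := Real.sqrt_le_one.2 h1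
      nlinarith
    · refine (hfar h).trans ?_
      have h2 : √|y| ≤ |y| := by
        rw [Real.sqrt_le_left hy0.le]; nlinarith
      rw [← sq_abs y]
      gcongr
      nlinarith
  · have hs0 : 0 < |s| := by linarith
    refine (hψ.norm_oscillatory_le_div_sqrt (fun x hx => (hM x hx).1) y (abs_pos.1 hs0)).trans ?_
    rw [div_le_div_iff₀ (Real.sqrt_pos.2 hs0) hsy]
    have h2 : √|y| ≤ 5 * √|s| := by
      rw [Real.sqrt_le_left (by positivity), mul_pow, Real.sq_sqrt hs0.le]
      linarith
    have := Real.sqrt_nonneg |s|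
    nlinarith [mul_le_mul_of_nonneg_left h2 (show 0 ≤ 50 * M by positivity)]

end IsCutoff

/-- The profile `|z|^{-1/2}` for `|z| ≤ 80` and `|z|^{-2}` beyond, as a function of `|z|`. -/
def kernelProfile (r : ℝ) : ℝ := if r ≤ 80 then r ^ (-(1 / 2) : ℝ) else r ^ (-2 : ℝ)

theorem kernelProfile_nonneg {r : ℝ} (hr : 0 ≤ r) : 0 ≤ kernelProfile r := by
  unfold kernelProfile
  split_ifs <;> positivity

theorem integrable_kernelProfile_rpow {p : ℝ} (hp1 : 1 ≤ p) (hp2 : p < 2) :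
    Integrable fun z : ℝ => kernelProfile |z| ^ p := by
  have hIoi : IntegrableOn (fun r : ℝ => kernelProfile r ^ p) (Set.Ioi 0) := by
    rw [← Set.Ioc_union_Ioi_eq_Ioi (show (0 : ℝ) ≤ 80 by norm_num)]
    refine IntegrableOn.union ?_ ?_
    · have h := (intervalIntegrable_iff_integrableOn_Ioc_of_le (by norm_num)).1
        (intervalIntegral.intervalIntegrable_rpow' (a := 0) (b := 80) (r := -(1 / 2) * p)
          (by linarith))
      refine h.congr_fun (fun r hr => ?_) measurableSet_Ioc
      simp only [kernelProfile, if_pos hr.2]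
      exact Real.rpow_mul hr.1.le _ _
    · have h := integrableOn_Ioi_rpow_of_lt (a := -2 * p) (by linarith)
        (show (0 : ℝ) < 80 by norm_num)
      refine h.congr_fun (fun r hr => ?_) measurableSet_Ioi
      have hr' : 80 < r := hr
      simp only [kernelProfile, if_neg (not_le.2 hr')]
      exact Real.rpow_mul (by linarith) _ _
  have hpos : IntegrableOn (fun z : ℝ => kernelProfile |z| ^ p) (Set.Ioi 0) :=
    hIoi.congr_fun (fun r hr => by rw [abs_of_pos hr]) measurableSet_Ioi
  have hneg : IntegrableOn (fun z : ℝ => kernelProfile |z| ^ p) (Set.Iio 0) := by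
    have h := (Measure.measurePreserving_neg (volume : Measure ℝ)).integrableOn_comp_preimage
      (Homeomorph.neg ℝ).measurableEmbedding (f := fun z : ℝ => kernelProfile |z| ^ p)
      (s := Set.Ioi 0)
    simpa [Function.comp_def] using h.2 hpos
  rw [← integrableOn_univ, ← Set.Iic_union_Ioi (a := (0 : ℝ))]
  exact IntegrableOn.union ((integrableOn_Iic_iff_integrableOn_Iio (by simp)).2 hneg) hpos

theorem IsCutoff.exists_kernel_bound {ψ : ℝ → ℝ} (hψ : IsCutoff ψ) :
    ∃ D : ℝ, 0 < D ∧ ∀ N x t : ℝ, 1 ≤ N → x ≠ 0 → |t| ≤ 1 →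
      ‖∫ ξ : ℝ, cexp (I * (x * ξ - t * ξ ^ 2)) * ((ψ (ξ / (4 * N)) : ℝ) : ℂ)‖
        ≤ D * kernelProfile |x / N| := by
  obtain ⟨C, hC, hb⟩ := hψ.exists_oscillatory_bound
  refine ⟨2 * C, by positivity, fun N x t hN hx ht => ?_⟩
  have hN0 : 0 < N := by linarith
  have hx0 : 0 < |x| := abs_pos.2 hx
  have hscale := Measure.integral_comp_div (fun η : ℝ =>
    cexp (I * ((4 * N * x : ℝ) * η - (16 * N ^ 2 * t : ℝ) * η ^ 2)) * (ψ η : ℂ)) (4 * N)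
  have heq : ∀ ξ : ℝ, cexp (I * ((4 * N * x : ℝ) * ((ξ / (4 * N) : ℝ) : ℂ) -
      (16 * N ^ 2 * t : ℝ) * ((ξ / (4 * N) : ℝ) : ℂ) ^ 2)) = cexp (I * (x * ξ - t * ξ ^ 2)) := by
    intro ξ
    have hNc : (N : ℂ) ≠ 0 := by exact_mod_cast hN0.ne'
    congr 2
    push_cast
    field_simp
    ring
  simp only [heq] at hscale
  rw [hscale, norm_smul, Real.norm_eq_abs, abs_abs, abs_of_pos (by positivity : 0 < 4 * N)]
  obtain ⟨hnear, hfar⟩ := hb (4 * N * x) (16 * N ^ 2 * t) (by positivity)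
  have hxN : |x / N| = |x| / N := by rw [abs_div, abs_of_pos hN0]
  unfold kernelProfile
  rw [hxN]
  split_ifs with h
  · refine (mul_le_mul_of_nonneg_left hnear (by positivity)).trans (le_of_eq ?_)
    have h1 : |4 * N * x| = (2 * N) ^ 2 * (|x| / N) := by
      rw [abs_mul, abs_of_pos (by positivity : 0 < 4 * N)]
      field_simp
      ring
    rw [h1, Real.sqrt_mul (by positivity), Real.sqrt_sq (by positivity),
      Real.rpow_neg (by positivity), ← Real.sqrt_eq_rpow]
    have : √(|x| / N) ≠ 0 := (Real.sqrt_pos.2 (by positivity)).ne'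
    field_simp
    ring
  · have h80 : 80 * N < |x| := by rwa [not_le, lt_div_iff₀ hN0] at h
    have hcond : 20 * |16 * N ^ 2 * t| ≤ |4 * N * x| := by
      rw [abs_mul (16 * N ^ 2), abs_mul (4 * N), abs_of_pos (by positivity : 0 < 4 * N),
        abs_of_pos (by positivity : 0 < 16 * N ^ 2)]
      nlinarith [mul_le_mul_of_nonneg_left ht (by positivity : 0 ≤ 320 * N ^ 2)]
    refine (mul_le_mul_of_nonneg_left (hfar hcond) (by positivity)).trans ?_
    rw [Real.rpow_neg (by positivity), Real.rpow_two, ← sq_abs (4 * N * x), abs_mul,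
      abs_of_pos (by positivity : 0 < 4 * N)]
    have h1 : 4 * N * (C / (4 * N * |x|) ^ 2) = C / (4 * N * |x| ^ 2) := by field_simp
    have h2 : 2 * C * ((|x| / N) ^ 2)⁻¹ = 2 * C * N ^ 2 / |x| ^ 2 := by field_simp
    rw [h1, h2, div_le_div_iff₀ (by positivity) (by positivity)]
    have h3 : 1 ≤ N ^ 3 := one_le_pow₀ hN
    nlinarith [mul_le_mul_of_nonneg_left h3 (by positivity : 0 ≤ C * |x| ^ 2)]

theorem lintegral_ofReal_kernelProfile {p : ℝ} (hp1 : 1 ≤ p) (hp2 : p < 2) {D N : ℝ} (hD : 0 ≤ D)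
    (hN : 0 < N) :
    ∫⁻ x : ℝ, ENNReal.ofReal (D * kernelProfile |x / N|) ^ p =
      ENNReal.ofReal (D ^ p * (N * ∫ z : ℝ, kernelProfile |z| ^ p)) := by
  have hnn : ∀ x : ℝ, 0 ≤ kernelProfile |x / N| := fun x => kernelProfile_nonneg (abs_nonneg _)
  have h1 : ∀ x : ℝ, ENNReal.ofReal (D * kernelProfile |x / N|) ^ p =
      ENNReal.ofReal (D ^ p * kernelProfile |x / N| ^ p) := by
    intro x
    rw [ENNReal.ofReal_rpow_of_nonneg (mul_nonneg hD (hnn x)) (by linarith),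
      Real.mul_rpow hD (hnn x)]
  simp_rw [h1]
  rw [← ofReal_integral_eq_lintegral_ofReal]
  · rw [integral_const_mul, Measure.integral_comp_div (fun z => kernelProfile |z| ^ p) N,
      abs_of_pos hN, smul_eq_mul]
  · exact ((integrable_kernelProfile_rpow hp1 hp2).comp_div hN.ne').const_mul _
  · exact Filter.Eventually.of_forall fun x =>
      mul_nonneg (Real.rpow_nonneg hD _) (Real.rpow_nonneg (hnn x) _)

/-- **Kernel estimate, truncated case.**
Let `γ ∈ {2,3}`. There is `c > 0` such that for every `N ∈ 2^ℕ`, the kernel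
`K₁(x,t) = ∫ e^{−itξ²+ixξ} χ_{[−2,2]}(t) ψ(ξ/(4N)) dξ` satisfies
`‖K₁‖_{L^{γ/2}_x L^∞_t(ℝ×[−1,1])} ≤ c N^{2/γ}`. -/
theorem kernel_estimate_truncated (ψ : ℝ → ℝ) (hψ : IsCutoff ψ)
    (γ : ℝ) (hγ : γ = 2 ∨ γ = 3) :
    ∃ c : ℝ, 0 < c ∧
      ∀ (n : ℕ) (N : ℝ), N = (2 : ℝ) ^ n →
        mixed (ENNReal.ofReal (γ / 2)) ⊤ (Set.Icc (-1 : ℝ) 1)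
            (fun x t => ∫ ξ : ℝ, Complex.exp (Complex.I * (x * ξ - t * ξ ^ 2)) *
              Set.indicator (Set.Icc (-2 : ℝ) 2) (fun _ => (1 : ℂ)) t *
              ((ψ (ξ / (4 * N)) : ℝ) : ℂ))
          ≤ ENNReal.ofReal (c * N ^ (2 / γ)) := by
  obtain ⟨D, hD, hbound⟩ := hψ.exists_kernel_bound
  have hp1 : 1 ≤ γ / 2 := by rcases hγ with rfl | rfl <;> norm_num
  have hp2 : γ / 2 < 2 := by rcases hγ with rfl | rfl <;> norm_num
  have hγp : 2 / γ = 1 / (γ / 2) := by field_simp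
  rw [hγp]
  set p := γ / 2
  have hp0 : 0 < p := by linarith
  set J := ∫ z : ℝ, kernelProfile |z| ^ p
  have hJ : 0 ≤ J := integral_nonneg fun z => Real.rpow_nonneg (kernelProfile_nonneg (abs_nonneg z)) _
  refine ⟨(D ^ p * J) ^ (1 / p) + 1, by positivity, fun n N hNn => ?_⟩
  have hN : 1 ≤ N := hNn ▸ one_le_pow₀ (by norm_num)
  have hN0 : 0 < N := by linarith
  rw [mixed, if_neg ENNReal.ofReal_ne_top, ENNReal.toReal_ofReal hp0.le]
  have hae : ∀ᵐ x : ℝ, x ≠ 0 := by simp [ae_iff]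
  calc _ ≤ (∫⁻ x : ℝ, ENNReal.ofReal (D * kernelProfile |x / N|) ^ p) ^ (1 / p) := by
        refine ENNReal.rpow_le_rpow (lintegral_mono_ae ?_) (by positivity)
        filter_upwards [hae] with x hx
        refine ENNReal.rpow_le_rpow ?_ hp0.le
        rw [eLpNorm_exponent_top]
        refine eLpNormEssSup_le_of_ae_bound ?_
        refine (ae_restrict_iff' measurableSet_Icc).2 (Filter.Eventually.of_forall fun t ht => ?_)
        have ht2 : t ∈ Set.Icc (-2 : ℝ) 2 := ⟨by linarith [ht.1], by linarith [ht.2]⟩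
        simp only [Set.indicator_of_mem ht2, mul_one]
        exact hbound N x t hN hx (abs_le.2 ht)
    _ = ENNReal.ofReal ((D ^ p * J) ^ (1 / p) * N ^ (1 / p)) := by
        rw [lintegral_ofReal_kernelProfile hp1 hp2 hD.le hN0,
          ENNReal.ofReal_rpow_of_nonneg (by positivity) (by positivity),
          ← Real.mul_rpow (by positivity) hN0.le]
        congr 2
        ring
    _ ≤ _ := by
        refine ENNReal.ofReal_le_ofReal ?_
        gcongr
        linarith

end
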